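/- arXiv:2201.10250 — 2 statements merged into one kernel-verified Lean document; each statement's English description precedes it below -/
import Mathlib

section
/- Lemma 2 (data-driven lower bound on the optimal delay). For every user-to-cache association g, the average delay satisfies T̄(g) ≥ (1/S) Σ_{s=1}^{S} ( ⌊d_s/Λ⌋ + 1 ) · (Λ−t)/(1+t) − (1/S) Σ_{s ∈ S₂} C(Λ−A_s, t+1)/C(Λ,t), where A_s = d_s − Λ⌊d_s/Λ⌋ and S₂ = { s ∈ {1,…,S} : A_s < Λ−t }. In particular the optimal average delay over all associations is bounded below by this quantity. -/
open Finset

noncomputable section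

/-- Decreasing rearrangement of a tuple of naturals, indexed by `ℕ`
(value `0` out of range): `sortDescN v 0` is the largest entry. -/
def sortDescN {Λ : ℕ} (v : Fin Λ → ℕ) (i : ℕ) : ℕ :=
  if h : i < Λ then (v ∘ Tuple.sort v) (Fin.rev ⟨i, h⟩) else 0

/-- Load of cache `c` at time slot `s` under activity matrix `D` and association `g`. -/
def loadD {S K Λ : ℕ} (D : Fin S → Fin K → Bool) (g : Fin K → Fin Λ)
    (s : Fin S) (c : Fin Λ) : ℕ :=
  ∑ k, if g k = c ∧ D s k = true then 1 else 0

/-- Total number of active users at time slot `s`: `d_s = ∑_k d_{s,k}`. -/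
def dTot {S K : ℕ} (D : Fin S → Fin K → Bool) (s : Fin S) : ℕ :=
  ∑ k, if D s k = true then 1 else 0

/-- Average delay in the data-driven setting:
`T̄(g) = (1/S) ∑_{s=1}^S ∑_{λ=1}^{Λ-t} l_{s,λ} C(Λ-λ,t)/C(Λ,t)`. -/
def avgDelayD {S K Λ : ℕ} (D : Fin S → Fin K → Bool) (g : Fin K → Fin Λ) (t : ℕ) : ℝ :=
  (1 / (S : ℝ)) *
    ∑ s : Fin S, ∑ i ∈ Finset.range (Λ - t),
      (sortDescN (loadD D g s) i : ℝ) * ((Λ - 1 - i).choose t : ℝ) / (Λ.choose t : ℝ)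

/-- Hockey-stick identity, truncated after `A` terms. -/
theorem sum_range_choose_add_choose {n A : ℕ} (t : ℕ) (hA : A ≤ n) :
    (∑ i ∈ range A, (n - 1 - i).choose t) + (n - A).choose (t + 1) = n.choose (t + 1) := by
  induction A with
  | zero => simp
  | succ A ih =>
    rw [← ih (by omega), sum_range_succ, add_assoc]
    obtain ⟨m, hm⟩ : ∃ m, n = m + 1 + A := ⟨n - (A + 1), by omega⟩
    have h₁ : n - 1 - A = m := by omega
    have h₂ : n - (A + 1) = m := by omega
    have h₃ : n - A = m + 1 := by omega
    rw [h₁, h₂, h₃, Nat.choose_succ_succ]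

/-- Among antitone integer sequences of given total, the most balanced one minimises every
weighted sum with antitone weights. -/
theorem sum_balanced_mul_le {n q A : ℕ} {l : ℕ → ℕ} {w : ℕ → ℝ}
    (hl : ∀ i j, i ≤ j → j < n → l j ≤ l i) (hw : Antitone w) (hw₀ : ∀ i, 0 ≤ w i)
    (hsum : ∑ i ∈ range n, l i = ∑ i ∈ range n, (q + if i < A then 1 else 0)) :
    ∑ i ∈ range n, ((q + if i < A then 1 else 0 : ℕ) : ℝ) * w i ≤
      ∑ i ∈ range n, (l i : ℝ) * w i := by
  set m : ℕ → ℕ := fun i => q + if i < A then 1 else 0 with hm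
  change ∑ i ∈ range n, (m i : ℝ) * w i ≤ _
  by_cases hex : ∃ p, p < n ∧ l p < m p
  · classical
    obtain ⟨hpn, hp⟩ := Nat.find_spec hex
    have hmin : ∀ i < Nat.find hex, ¬ (i < n ∧ l i < m i) := fun i hi => Nat.find_min hex hi
    generalize Nat.find hex = p at hpn hp hmin
    have hcast : ∑ i ∈ range n, (l i : ℝ) = ∑ i ∈ range n, (m i : ℝ) := by exact_mod_cast hsum
    have hnonneg : 0 ≤ ∑ i ∈ range n, ((l i : ℝ) - m i) * (w i - w p) := by
      refine sum_nonneg fun i hi => ?_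
      rw [mem_range] at hi
      rcases lt_or_ge i p with hip | hip
      · have h : m i ≤ l i := not_lt.1 fun h => hmin i hip ⟨hi, h⟩
        exact mul_nonneg (sub_nonneg.2 (by exact_mod_cast h)) (sub_nonneg.2 (hw hip.le))
      · have h : l i ≤ m i := by
          have := hl p i hip hi
          simp only [hm] at hp ⊢
          split_ifs at hp ⊢ <;> omega
        exact mul_nonneg_of_nonpos_of_nonpos (sub_nonpos.2 (by exact_mod_cast h))
          (sub_nonpos.2 (hw hip))
    have hexpand : ∑ i ∈ range n, ((l i : ℝ) - m i) * (w i - w p) =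
        (∑ i ∈ range n, (l i : ℝ) * w i - ∑ i ∈ range n, (m i : ℝ) * w i) -
          (∑ i ∈ range n, (l i : ℝ) - ∑ i ∈ range n, (m i : ℝ)) * w p := by
      rw [← sum_sub_distrib, ← sum_sub_distrib, sum_mul, ← sum_sub_distrib]
      exact sum_congr rfl fun i _ => by ring
    rw [hexpand, hcast] at hnonneg
    linarith
  · push Not at hex
    exact sum_le_sum fun i hi => mul_le_mul_of_nonneg_right
      (by exact_mod_cast hex i (mem_range.1 hi)) (hw₀ i)

theorem sortDescN_le_sortDescN {n : ℕ} (v : Fin n → ℕ) {i j : ℕ} (hij : i ≤ j) (hj : j < n) :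
    sortDescN v j ≤ sortDescN v i := by
  rw [sortDescN, sortDescN, dif_pos hj, dif_pos (hij.trans_lt hj)]
  exact Tuple.monotone_sort v (Fin.rev_le_rev.2 hij)

theorem sum_range_sortDescN {n : ℕ} (v : Fin n → ℕ) :
    ∑ i ∈ range n, sortDescN v i = ∑ c, v c := by
  rw [← Fin.sum_univ_eq_sum_range]
  simp only [sortDescN, Fin.is_lt, dif_pos, Function.comp_apply, Fin.eta]
  exact Equiv.sum_comp (Fin.revPerm.trans (Tuple.sort v)) v

theorem sum_loadD {S K Λ : ℕ} (D : Fin S → Fin K → Bool) (g : Fin K → Fin Λ) (s : Fin S) :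
    ∑ c, loadD D g s c = dTot D s := by
  simp only [loadD, dTot]
  rw [sum_comm]
  refine sum_congr rfl fun k _ => ?_
  simp only [ite_and]
  simp

theorem sum_range_balanced {n A q : ℕ} (hA : A ≤ n) (w : ℕ → ℝ) :
    ∑ i ∈ range n, ((q + if i < A then 1 else 0 : ℕ) : ℝ) * w i =
      q * ∑ i ∈ range n, w i + ∑ i ∈ range A, w i := by
  have hfilter : (range n).filter (· < A) = range A := by
    ext i
    simp only [mem_filter, mem_range]
    omega
  rw [mul_sum, ← hfilter, sum_filter, ← sum_add_distrib]
  refine sum_congr rfl fun i _ => ?_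
  split_ifs <;> push_cast <;> ring

theorem le_sum_sortDescN_mul_choose {n t : ℕ} (hn : 0 < n) (v : Fin n → ℕ) :
    (((∑ c, v c) / n : ℕ) + 1 : ℝ) * n.choose (t + 1) - (n - (∑ c, v c) % n).choose (t + 1) ≤
      ∑ i ∈ range (n - t), (sortDescN v i : ℝ) * (n - 1 - i).choose t := by
  set d := ∑ c, v c with hd
  have hA : d % n ≤ n := (Nat.mod_lt d hn).le
  have hbal := sum_balanced_mul_le (n := n) (q := d / n) (A := d % n) (l := sortDescN v)
    (w := fun i => ((n - 1 - i).choose t : ℝ))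
    (fun i j hij hj => sortDescN_le_sortDescN v hij hj)
    (fun i j hij => by
      dsimp only
      exact_mod_cast Nat.choose_le_choose t (Nat.sub_le_sub_left hij _))
    (fun i => Nat.cast_nonneg _)
    (by
      rw [sum_range_sortDescN, ← hd]
      have h := sum_range_balanced (q := d / n) hA (fun _ => 1)
      simp only [mul_one, sum_const, card_range, nsmul_eq_mul] at h
      have h' : ∑ i ∈ range n, (d / n + if i < d % n then 1 else 0) = d / n * n + d % n := by
        exact_mod_cast h
      rw [h', Nat.div_add_mod'])
  rw [sum_range_balanced hA] at hbal
  have hfull : ∑ i ∈ range n, ((n - 1 - i).choose t : ℝ) = n.choose (t + 1) := by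
    have h := sum_range_choose_add_choose t (le_refl n)
    rw [Nat.sub_self, Nat.choose_zero_succ, add_zero] at h
    exact_mod_cast h
  have hpart : ∑ i ∈ range (d % n), ((n - 1 - i).choose t : ℝ) +
      (n - d % n).choose (t + 1) = n.choose (t + 1) := by
    exact_mod_cast sum_range_choose_add_choose t hA
  have htrunc : ∑ i ∈ range (n - t), (sortDescN v i : ℝ) * (n - 1 - i).choose t =
      ∑ i ∈ range n, (sortDescN v i : ℝ) * (n - 1 - i).choose t := by
    refine sum_subset (range_subset_range.2 (Nat.sub_le n t)) fun i hi hi' => ?_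
    rw [mem_range] at hi hi'
    rw [Nat.choose_eq_zero_of_lt (by omega), Nat.cast_zero, mul_zero]
  rw [hfull] at hbal
  rw [htrunc]
  linarith

/-- Lemma 2 (data-driven lower bound on the optimal delay), with
`A_s = d_s - Λ⌊d_s/Λ⌋` and `S₂ = {s : A_s < Λ - t}`. -/
theorem lemma2_data_driven_lower_bound {S K Λ t : ℕ} (hΛ : 2 ≤ Λ) (ht1 : 1 ≤ t)
    (ht2 : t ≤ Λ - 1) (hS : 1 ≤ S) (D : Fin S → Fin K → Bool) (g : Fin K → Fin Λ) :
    (1 / (S : ℝ)) *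
        (∑ s : Fin S, (((dTot D s / Λ : ℕ) : ℝ) + 1) * (((Λ : ℝ) - t) / (1 + t))) -
      (1 / (S : ℝ)) *
        (∑ s ∈ Finset.univ.filter
            (fun s : Fin S => dTot D s - Λ * (dTot D s / Λ) < Λ - t),
          ((Λ - (dTot D s - Λ * (dTot D s / Λ))).choose (t + 1) : ℝ) / (Λ.choose t : ℝ)) ≤
      avgDelayD D g t := by
  rw [avgDelayD, ← mul_sub]
  refine mul_le_mul_of_nonneg_left ?_ (by positivity)
  rw [sum_filter, ← sum_sub_distrib]
  refine sum_le_sum fun s _ => ?_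
  have hC : (0 : ℝ) < Λ.choose t := by
    exact_mod_cast Nat.choose_pos (by omega)
  have hmod : dTot D s - Λ * (dTot D s / Λ) = dTot D s % Λ := by
    have := Nat.div_add_mod (dTot D s) Λ
    omega
  have hratio : ((Λ : ℝ) - t) / (1 + t) = Λ.choose (t + 1) / Λ.choose t := by
    have h : (Λ.choose (t + 1) : ℝ) * (t + 1) = Λ.choose t * ((Λ : ℝ) - t) := by
      rw [← Nat.cast_sub (by omega)]
      exact_mod_cast Nat.choose_succ_right_eq Λ t
    rw [div_eq_div_iff (by positivity) hC.ne']
    linarith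
  have hfilter : (if dTot D s % Λ < Λ - t then
      ((Λ - dTot D s % Λ).choose (t + 1) : ℝ) / (Λ.choose t : ℝ) else 0) =
      ((Λ - dTot D s % Λ).choose (t + 1) : ℝ) / (Λ.choose t : ℝ) := by
    split_ifs with h
    · rfl
    · rw [Nat.choose_eq_zero_of_lt (by omega), Nat.cast_zero, zero_div]
  have hmain := le_sum_sortDescN_mul_choose (t := t) (by omega) (loadD D g s)
  rw [sum_loadD] at hmain
  rw [hmod, hfilter, hratio, ← sum_div, ← mul_div_assoc, ← sub_div]
  exact div_le_div_of_nonneg_right hmain hC.le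

end
end

section
/- Data-driven floor lower bound. For every user-to-cache association g, the average delay satisfies T̄(g) ≥ (1/S) Σ_{s=1}^{S} ⌊d_s/Λ⌋ · (Λ−t)/(1+t). -/
open Finset

noncomputable section

theorem sum_sortDescN {Λ : ℕ} (v : Fin Λ → ℕ) :
    ∑ i ∈ range Λ, sortDescN v i = ∑ c, v c := by
  rw [Finset.sum_range]
  have h : ∀ i : Fin Λ, sortDescN v i = v (Tuple.sort v (Fin.rev i)) := fun i => by
    simp [sortDescN]
  simp_rw [h]
  exact (Fin.revPerm.trans (Tuple.sort v)).sum_comp v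

theorem sortDescN_antitone {Λ : ℕ} (v : Fin Λ → ℕ) : Antitone (sortDescN v) := by
  intro i j hij
  by_cases hj : j < Λ
  · have hi : i < Λ := hij.trans_lt hj
    simp only [sortDescN, hi, hj, dif_pos]
    exact Tuple.monotone_sort v (Fin.rev_le_rev.mpr hij)
  · simp [sortDescN, hj]

theorem sum_range_choose_reflect (n t : ℕ) :
    ∑ i ∈ range n, (n - 1 - i).choose t = n.choose (t + 1) := by
  rw [Finset.sum_range_reflect (fun j => j.choose t) n]
  induction n with
  | zero => simp
  | succ n ih => rw [Finset.sum_range_succ, ih, Nat.choose_succ_succ', add_comm]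

/-- Chebyshev's sum inequality for the sorted loads and the binomial weights. -/
theorem sum_mul_choose_le {Λ : ℕ} (v : Fin Λ → ℕ) (t : ℕ) :
    (∑ c, v c) * Λ.choose (t + 1) ≤
      Λ * ∑ i ∈ range (Λ - t), sortDescN v i * (Λ - 1 - i).choose t := by
  have hw : Antitone fun i => (Λ - 1 - i).choose t := fun i j hij =>
    Nat.choose_le_choose t (Nat.sub_le_sub_left hij _)
  have hc := ((sortDescN_antitone v).monovary hw).monovaryOn (range Λ : Set ℕ)
    |>.sum_mul_sum_le_card_mul_sum
  rw [sum_sortDescN, sum_range_choose_reflect, card_range] at hc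
  refine hc.trans_eq ?_
  congr 1
  symm
  refine Finset.sum_subset (range_subset_range.mpr (Nat.sub_le _ _)) fun i hi hi' => ?_
  rw [mem_range] at hi hi'
  rw [Nat.choose_eq_zero_of_lt (by omega), mul_zero]

theorem floor_mul_le_delay {Λ t : ℕ} (hΛ : 0 < Λ) (ht : t ≤ Λ) (v : Fin Λ → ℕ) :
    (((∑ c, v c) / Λ : ℕ) : ℝ) * (((Λ : ℝ) - t) / (1 + t)) ≤
      ∑ i ∈ range (Λ - t),
        (sortDescN v i : ℝ) * ((Λ - 1 - i).choose t : ℝ) / (Λ.choose t : ℝ) := by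
  have hC : (0 : ℝ) < Λ.choose t := by exact_mod_cast Nat.choose_pos ht
  have hΛ' : (0 : ℝ) < Λ := by exact_mod_cast hΛ
  have hfloor : (∑ c, v c) / Λ * Λ.choose (t + 1) ≤
      ∑ i ∈ range (Λ - t), sortDescN v i * (Λ - 1 - i).choose t := by
    refine Nat.le_of_mul_le_mul_left ?_ hΛ
    refine le_trans ?_ (sum_mul_choose_le v t)
    rw [← mul_assoc]
    exact Nat.mul_le_mul_right _ (Nat.mul_div_le _ _)
  have hratio : ((Λ : ℝ) - t) / (1 + t) = Λ.choose (t + 1) / Λ.choose t := by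
    have h : (Λ.choose (t + 1) : ℝ) * (t + 1) = Λ.choose t * ((Λ : ℝ) - t) := by
      rw [← Nat.cast_sub ht]
      exact_mod_cast Nat.choose_succ_right_eq Λ t
    rw [div_eq_div_iff (by positivity) hC.ne']
    linarith
  rw [← Finset.sum_div, hratio, ← mul_div_assoc]
  gcongr
  exact_mod_cast hfloor

/-- Data-driven floor lower bound: for every association `g`,
`T̄(g) ≥ (1/S) ∑_s ⌊d_s/Λ⌋ (Λ-t)/(1+t)`. -/
theorem data_driven_floor_lower_bound {S K Λ t : ℕ} (hΛ : 2 ≤ Λ) (ht1 : 1 ≤ t)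
    (ht2 : t ≤ Λ - 1) (hS : 1 ≤ S) (D : Fin S → Fin K → Bool) (g : Fin K → Fin Λ) :
    (1 / (S : ℝ)) *
        ∑ s : Fin S, ((dTot D s / Λ : ℕ) : ℝ) * (((Λ : ℝ) - t) / (1 + t)) ≤
      avgDelayD D g t := by
  refine mul_le_mul_of_nonneg_left (Finset.sum_le_sum fun s _ => ?_) (by positivity)
  rw [← sum_loadD D g s]
  exact floor_mul_le_delay (by omega) (by omega) _

end
end
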